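/- arXiv:2208.03073 — 2 statements merged into one kernel-verified Lean document; each statement's English description precedes it below -/
import Mathlib

section
/- Let R be a commutative ring and p a prime number. Let φ : R → R/pR be the ring homomorphism sending x to x^p + pR (the composite of the quotient map R → R/pR with the Frobenius endomorphism of the characteristic-p ring R/pR). Then for every invertible R-module L, there is an (R/pR)-linear isomorphism between the base change of L along φ, i.e. (R/pR) ⊗_{R,φ} L, and the p-fold tensor power over R/pR of the reduction L/pL = (R/pR) ⊗_R L. -/
open scoped TensorProduct

universe u

/-- The codomain of a ring homomorphism `f : R →+* S`, viewed as an `R`-algebra via `f`,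
so that `Along f ⊗[R] L` is the base change of an `R`-module `L` along `f`. -/
def Along {R S : Type*} [CommRing R] [CommRing S] (_f : R →+* S) : Type _ := S

instance {R S : Type*} [CommRing R] [CommRing S] (f : R →+* S) : CommRing (Along f) :=
  inferInstanceAs (CommRing S)

instance {R S : Type*} [CommRing R] [CommRing S] (f : R →+* S) : Algebra R (Along f) :=
  RingHom.toAlgebra f

/-- `L` is an invertible `R`-module, i.e. it admits a tensor inverse `M`. -/
def IsInvertibleModule (R : Type u) (L : Type u) [CommRing R] [AddCommGroup L] [Module R L] :
    Prop :=
  ∃ (M : Type u) (_ : AddCommGroup M) (_ : Module R M), Nonempty ((L ⊗[R] M) ≃ₗ[R] R)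

/-- If `x` generates `L` with coordinates `f`, and `q` generates an `A`-module `P` with coordinates
`h` such that the coordinates of `q` are the images in `A` of those of `x`, then `P` is the base
change of `L` to `A`. -/
theorem nonempty_baseChange_equiv_of_coordinates {R A L P ι : Type*} [CommRing R] [CommRing A]
    [Algebra R A] [AddCommGroup L] [Module R L] [AddCommMonoid P] [Module A P] [Fintype ι]
    (f : ι → L →ₗ[R] R) (x : ι → L) (hx : ∀ y, ∑ i, f i y • x i = y)
    (h : ι → P →ₗ[A] A) (q : ι → P) (hq : ∀ t, ∑ i, h i t • q i = t)
    (hfh : ∀ i j, h i (q j) = algebraMap R A (f i (x j))) :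
    Nonempty ((A ⊗[R] L) ≃ₗ[A] P) := by
  let F : A ⊗[R] L →ₗ[A] P :=
    ∑ i, (LinearMap.toSpanSingleton A P (q i)) ∘ₗ
      (TensorProduct.AlgebraTensorModule.rid R A A).toLinearMap ∘ₗ (f i).baseChange A
  let G : P →ₗ[A] A ⊗[R] L := ∑ i, (LinearMap.toSpanSingleton A _ (1 ⊗ₜ[R] x i)) ∘ₗ h i
  have hF (y : L) : F (1 ⊗ₜ y) = ∑ i, algebraMap R A (f i y) • q i := by
    simp [F, Algebra.algebraMap_eq_smul_one]
  have hG (t : P) : G t = ∑ i, h i t • (1 ⊗ₜ[R] x i) := by simp [G]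
  have expand (y : L) : ∑ i, algebraMap R A (f i y) • ((1 : A) ⊗ₜ[R] x i) = 1 ⊗ₜ y := by
    simp_rw [algebraMap_smul, ← TensorProduct.tmul_smul, ← TensorProduct.tmul_sum, hx]
  have hFx (i : ι) : F (1 ⊗ₜ x i) = q i := by
    simp_rw [hF, ← hfh, hq]
  have hGq (i : ι) : G (q i) = 1 ⊗ₜ x i := by
    simp_rw [hG, hfh, expand]
  refine ⟨LinearEquiv.ofLinearMap F G ?_ ?_⟩
  · ext t
    simp [hG, map_sum, hFx, hq]
  · ext y
    simpa [hF, map_sum, hGq] using expand y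

/-- The version of `nonempty_baseChange_equiv_of_coordinates` for base change along a ring
homomorphism `φ : R →+* S`. -/
theorem nonempty_along_equiv_of_coordinates {R S L P ι : Type*} [CommRing R] [CommRing S]
    (φ : R →+* S) [AddCommGroup L] [Module R L] [AddCommMonoid P] [Module S P] [Fintype ι]
    (f : ι → L →ₗ[R] R) (x : ι → L) (hx : ∀ y, ∑ i, f i y • x i = y)
    (h : ι → P →ₗ[S] S) (q : ι → P) (hq : ∀ t, ∑ i, h i t • q i = t)
    (hfh : ∀ i j, h i (q j) = φ (f i (x j))) :
    letI : Module (Along φ) P := inferInstanceAs (Module S P)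
    Nonempty ((Along φ ⊗[R] L) ≃ₗ[Along φ] P) :=
  let _ : Module (Along φ) P := inferInstanceAs (Module S P)
  nonempty_baseChange_equiv_of_coordinates (A := Along φ) f x hx h q hq hfh

/-- An invertible module has finitely many generators `x` with coordinates `f` such that
`∑ i, f i (x i) = 1`. -/
theorem IsInvertibleModule.exists_coordinates {R L : Type u} [CommRing R] [AddCommGroup L]
    [Module R L] (hL : IsInvertibleModule R L) :
    ∃ (n : ℕ) (f : Fin n → L →ₗ[R] R) (x : Fin n → L),
      (∑ i, f i (x i) = 1) ∧ ∀ i y z, f i y • z = f i z • y := by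
  obtain ⟨M, _, _, ⟨e⟩⟩ := hL
  have : Module.Invertible R L := .left e
  obtain ⟨n, x, m, hxm⟩ := TensorProduct.exists_sum_tmul_eq (e.symm 1)
  refine ⟨n, fun i ↦ e.toLinearMap ∘ₗ (TensorProduct.mk R L M).flip (m i), x, ?_, fun i y z ↦ ?_⟩
  · simp [← map_sum, ← hxm]
  · simpa using congr(TensorProduct.lift ((LinearMap.lsmul R L).comp
      (e.toLinearMap ∘ₗ (TensorProduct.mk R L M).flip (m i)))
      $(Module.Invertible.tmul_comm (R := R) (m₁ := y) (m₂ := z)))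

/-- Expansion of an element of the tensor power of `S ⊗[R] L` in terms of the pure powers of a
system of generators of `L`. -/
theorem sum_lift_mkPiAlgebra_smul_tprod {R S L ι κ : Type*} [CommRing R] [CommRing S] [Algebra R S]
    [AddCommGroup L] [Module R L] [Fintype ι] [Fintype κ]
    (f : ι → L →ₗ[R] R) (x : ι → L) (hf : ∀ i y z, f i y • z = f i z • y)
    (hx : ∑ i, algebraMap R S (f i (x i)) ^ Fintype.card κ = 1)
    (t : ⨂[S] _ : κ, S ⊗[R] L) :
    ∑ i, PiTensorProduct.lift ((MultilinearMap.mkPiAlgebra S κ S).compLinearMap fun _ ↦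
        (TensorProduct.AlgebraTensorModule.rid R S S).toLinearMap ∘ₗ (f i).baseChange S) t •
      PiTensorProduct.tprod S (fun _ ↦ (1 : S) ⊗ₜ[R] x i) = t := by
  let g (i : ι) : S ⊗[R] L →ₗ[S] S :=
    (TensorProduct.AlgebraTensorModule.rid R S S).toLinearMap ∘ₗ (f i).baseChange S
  have hg (i : ι) (w : S ⊗[R] L) :
      g i w • ((1 : S) ⊗ₜ[R] x i) = algebraMap R S (f i (x i)) • w := by
    induction w with
    | zero => simp
    | add a b ha hb => rw [map_add, add_smul, ha, hb, smul_add]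
    | tmul s y =>
      simp only [g, LinearMap.comp_apply, LinearMap.baseChange_tmul, LinearEquiv.coe_coe,
        TensorProduct.AlgebraTensorModule.rid_tmul, algebraMap_smul]
      rw [TensorProduct.smul_tmul', smul_eq_mul, mul_one, TensorProduct.smul_tmul, hf,
        TensorProduct.tmul_smul]
  induction t using PiTensorProduct.induction_on with
  | smul_tprod r w =>
    simp only [map_smul, PiTensorProduct.lift.tprod, MultilinearMap.compLinearMap_apply,
      MultilinearMap.mkPiAlgebra_apply, smul_assoc, ← Finset.smul_sum]
    congr 1
    have key (i : ι) : (∏ k, g i (w k)) • PiTensorProduct.tprod S (fun _ ↦ (1 : S) ⊗ₜ[R] x i) =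
        algebraMap R S (f i (x i)) ^ Fintype.card κ • PiTensorProduct.tprod S w := by
      rw [← MultilinearMap.map_smul_univ]
      simp_rw [hg]
      rw [MultilinearMap.map_smul_univ, Finset.prod_const, Finset.card_univ]
    exact (Finset.sum_congr rfl fun i _ ↦ key i).trans (by rw [← Finset.sum_smul, hx, one_smul])
  | add a b ha hb => simp only [map_add, add_smul, Finset.sum_add_distrib, ha, hb]

/-- If `φ : R →+* S` is the `n`-th power of the structure map of an `R`-algebra `S`, then the base
change of an invertible `R`-module `L` along `φ` is the `n`-fold tensor power of `S ⊗[R] L`. -/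
theorem IsInvertibleModule.nonempty_along_equiv_tensorPower {R L : Type u} {S : Type*} [CommRing R]
    [AddCommGroup L] [Module R L] (hL : IsInvertibleModule R L) [CommRing S] [Algebra R S]
    (n : ℕ) (φ : R →+* S) (hφ : ∀ x, φ x = algebraMap R S x ^ n) :
    letI : Module (Along φ) (⨂[S] _ : Fin n, S ⊗[R] L) :=
      inferInstanceAs (Module S (⨂[S] _ : Fin n, S ⊗[R] L))
    Nonempty ((Along φ ⊗[R] L) ≃ₗ[Along φ] ⨂[S] _ : Fin n, S ⊗[R] L) := by
  obtain ⟨m, f, x, hx, hf⟩ := hL.exists_coordinates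
  let h (i : Fin m) : (⨂[S] _ : Fin n, S ⊗[R] L) →ₗ[S] S :=
    PiTensorProduct.lift ((MultilinearMap.mkPiAlgebra S (Fin n) S).compLinearMap fun _ ↦
      (TensorProduct.AlgebraTensorModule.rid R S S).toLinearMap ∘ₗ (f i).baseChange S)
  let q (i : Fin m) : ⨂[S] _ : Fin n, S ⊗[R] L := PiTensorProduct.tprod S fun _ ↦ 1 ⊗ₜ[R] x i
  have hcoord (y : L) : ∑ i, f i y • x i = y := by
    simp_rw [hf _ y, ← Finset.sum_smul, hx, one_smul]
  have hq (t : ⨂[S] _ : Fin n, S ⊗[R] L) : ∑ i, h i t • q i = t := by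
    refine sum_lift_mkPiAlgebra_smul_tprod f x hf ?_ t
    simp_rw [Fintype.card_fin, ← hφ, ← map_sum, hx, map_one]
  have hfh (i j : Fin m) : h i (q j) = φ (f i (x j)) := by
    simp [h, q, hφ, Algebra.algebraMap_eq_smul_one]
  exact nonempty_along_equiv_of_coordinates φ f x hcoord h q hq hfh

/-- For a commutative ring `R`, a prime `p`, and the ring homomorphism
`φ : R → R/pR`, `x ↦ x^p + pR`, the base change of any invertible `R`-module `L` along `φ` is
`(R/pR)`-linearly isomorphic to the `p`-fold tensor power (over `R/pR`) of
`L/pL = (R/pR) ⊗[R] L`. -/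
theorem base_change_along_frobenius_of_quotient (R : Type u) [CommRing R]
    (p : ℕ) (hp : p.Prime)
    (φ : R →+* R ⧸ Ideal.span {(p : R)})
    (hφ : ∀ x : R, φ x = Ideal.Quotient.mk (Ideal.span {(p : R)}) (x ^ p))
    (L : Type u) [AddCommGroup L] [Module R L] (hL : IsInvertibleModule R L) :
    letI : Module (Along φ)
        (⨂[R ⧸ Ideal.span {(p : R)}] (_ : Fin p), ((R ⧸ Ideal.span {(p : R)}) ⊗[R] L)) :=
      inferInstanceAs (Module (R ⧸ Ideal.span {(p : R)})
        (⨂[R ⧸ Ideal.span {(p : R)}] (_ : Fin p), ((R ⧸ Ideal.span {(p : R)}) ⊗[R] L)))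
    Nonempty ((Along φ ⊗[R] L) ≃ₗ[Along φ]
      (⨂[R ⧸ Ideal.span {(p : R)}] (_ : Fin p), ((R ⧸ Ideal.span {(p : R)}) ⊗[R] L))) := by
  exact hL.nonempty_along_equiv_tensorPower p φ fun x ↦ by rw [hφ, map_pow]; rfl
end

section
/- Let κ be a perfect commutative ring of characteristic p, i.e., p·1 = 0 in κ and the Frobenius endomorphism x ↦ x^p is bijective. Then for every invertible κ-module L there exists an invertible κ-module N whose p-fold tensor power N^{⊗p} over κ is κ-linearly isomorphic to L. -/
open scoped TensorProduct

universe u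

namespace Module.Invertible

/-- Invertibility is preserved by semilinear equivalences. -/
theorem of_semilinearEquiv {R S M N : Type*} [CommRing R] [CommRing S] [AddCommGroup M]
    [AddCommGroup N] [Module R M] [Module S N] {σ : R →+* S} {τ : S →+* R}
    [RingHomInvPair σ τ] [RingHomInvPair τ σ] (e : M ≃ₛₗ[σ] N) [Module.Invertible S N] :
    Module.Invertible R M :=
  letI : Module R (Module.Dual S N) := Module.compHom _ σ
  let eDual : Module.Dual S N ≃ₛₗ[σ] Module.Dual S N :=
    { AddEquiv.refl _ with map_smul' := fun _ _ => rfl }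
  let eRing : S ≃ₛₗ[τ] R :=
    { RingEquiv.ofRingHom τ σ (RingHomInvPair.comp_eq (σ := σ))
        (RingHomInvPair.comp_eq (σ := τ)) with
      map_smul' := fun r x => map_mul τ r x }
  .right ((TensorProduct.congr eDual e).trans ((linearEquiv S N).trans eRing))

instance piTensorProduct {R M : Type*} [CommRing R] [AddCommGroup M] [Module R M]
    [Module.Invertible R M] (n : ℕ) : Module.Invertible R (⨂[R] (_ : Fin n), M) := by
  induction n with
  | zero =>
    exact .congr (PiTensorProduct.isEmptyEquiv (R := R) (s := fun _ : Fin 0 => M) (Fin 0)).symm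
  | succ n ih =>
    have e : (⨂[R] (_ : Fin n), M) ⊗[R] M ≃ₗ[R] ⨂[R] (_ : Fin (n + 1)), M :=
      (PiTensorProduct.subsingletonEquiv (R := R) (s := fun _ : Fin 1 => M) 0).symm.lTensor _ ≪≫ₗ
        PiTensorProduct.tmulEquiv R M ≪≫ₗ PiTensorProduct.reindex R (fun _ => M) finSumFinEquiv
    exact .congr e

/-- If `N → L` is surjective and semilinear with respect to `x ↦ x ^ n`, then the `n`-th tensor
power of `N` is isomorphic to `L`. -/
theorem nonempty_piTensorProduct_equiv {R N L : Type*} [CommRing R] [AddCommGroup N]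
    [AddCommGroup L] [Module R N] [Module R L] [Module.Invertible R N] [Module.Invertible R L]
    (n : ℕ) {σ : R →+* R} (hσ : ∀ x, σ x = x ^ n) (e : N →ₛₗ[σ] L)
    (he : Function.Surjective e) : Nonempty ((⨂[R] (_ : Fin n), N) ≃ₗ[R] L) := by
  obtain ⟨m, f, g, -, -, hfg⟩ := Module.Finite.exists_comp_eq_id_of_projective R N
  let φ : MultilinearMap R (fun _ : Fin n => N) L :=
    (Fintype.linearCombination R fun i => e (f (Pi.single i 1))).compMultilinearMap
      ((MultilinearMap.mkPiAlgebra R (Fin n) (Fin m → R)).compLinearMap fun _ => g)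
  have hφ (y : N) : φ (fun _ => y) = e y := by
    conv_rhs => rw [← LinearMap.id_apply (R := R) y, ← hfg, LinearMap.comp_apply,
      pi_eq_sum_univ' (g y)]
    simp [φ, Fintype.linearCombination_apply, hσ]
  have hsurj : Function.Surjective (PiTensorProduct.lift φ) := fun x => by
    obtain ⟨y, rfl⟩ := he x
    exact ⟨PiTensorProduct.tprod R fun _ => y, by rw [PiTensorProduct.lift.tprod, hφ]⟩
  exact ⟨.ofBijective _ (bijective_of_surjective hsurj)⟩

end Module.Invertible

/-- Restriction of scalars along a ring isomorphism. -/
theorem RingHomInvPair.exists_semilinearEquiv {R S : Type*} [CommRing R] [CommRing S]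
    (σ : R →+* S) (τ : S →+* R) [RingHomInvPair σ τ] [RingHomInvPair τ σ]
    (L : Type u) [AddCommGroup L] [Module S L] :
    ∃ (N : Type u) (_ : AddCommGroup N) (_ : Module R N), Nonempty (N ≃ₛₗ[σ] L) :=
  letI : Module R L := Module.compHom L σ
  ⟨L, inferInstance, inferInstance, ⟨{ AddEquiv.refl L with map_smul' := fun _ _ => rfl }⟩⟩

/-- The `p`-th power map as a ring homomorphism. Unlike `frobenius`, this allows the zero ring. -/
def frobeniusOfCastEqZero {R : Type*} [CommRing R] {p : ℕ} (hp : p.Prime) (h : (p : R) = 0) :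
    R →+* R where
  __ := powMonoidHom p
  map_zero' := zero_pow hp.ne_zero
  map_add' x y := by
    obtain ⟨r, hr⟩ := exists_add_pow_prime_eq hp x y
    simpa [h] using hr

/-- If `κ` is a perfect commutative ring of characteristic `p` (i.e. `p • 1 = 0` in `κ` and the
Frobenius `x ↦ x ^ p` is bijective), then every invertible `κ`-module `L` is a `p`-th tensor
power: there is an invertible `κ`-module `N` with `N^{⊗ p} ≅ L`. -/
theorem exists_pth_root_of_invertible_module (p : ℕ) (hp : p.Prime)
    (κ : Type u) [CommRing κ] (hchar : (p : κ) = 0)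
    (hperf : Function.Bijective (fun x : κ => x ^ p))
    (L : Type u) [AddCommGroup L] [Module κ L] (hL : IsInvertibleModule κ L) :
    ∃ (N : Type u) (_ : AddCommGroup N) (_ : Module κ N),
      IsInvertibleModule κ N ∧ Nonempty ((⨂[κ] (_ : Fin p), N) ≃ₗ[κ] L) := by
  obtain ⟨M, _, _, ⟨eM⟩⟩ := hL
  have : Module.Invertible κ L := .left eM
  let F : κ ≃+* κ := .ofBijective (frobeniusOfCastEqZero hp hchar) hperf
  have := RingHomInvPair.of_ringEquiv F
  have := RingHomInvPair.of_ringEquiv F.symm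
  obtain ⟨N, _, _, ⟨e⟩⟩ :=
    RingHomInvPair.exists_semilinearEquiv (F : κ →+* κ) (F.symm : κ →+* κ) L
  have : Module.Invertible κ N := .of_semilinearEquiv e
  exact ⟨N, _, _,
    ⟨Module.Dual κ N, _, _, ⟨TensorProduct.comm .. ≪≫ₗ Module.Invertible.linearEquiv κ N⟩⟩,
    Module.Invertible.nonempty_piTensorProduct_equiv p (fun _ => rfl) e.toLinearMap e.surjective⟩
end
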